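/- There exists a constant C > 0 such that for every i ∈ Σ, every n ∈ ℕ, and all a, b ∈ [0,1]², the off-diagonal and top-diagonal Jacobian entries of S_{i|n} satisfy |g_{i|n,x}(a)| / |f_{i|n,x}(b)| ≤ C. -/

import Mathlib

open MeasureTheory Filter Set

noncomputable section

namespace FFL

/-- The unit square `[0,1]² ⊆ ℝ²`. -/
def sq : Set (ℝ × ℝ) := Set.Icc (0:ℝ) 1 ×ˢ Set.Icc (0:ℝ) 1

/-- The Euclidean metric on `ℝ²`. -/
def dE (a b : ℝ × ℝ) : ℝ := Real.sqrt ((a.1 - b.1) ^ 2 + (a.2 - b.2) ^ 2)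

/-- Squared Frobenius norm of a 2×2 real matrix. -/
def frobSq (A : Matrix (Fin 2) (Fin 2) ℝ) : ℝ := ∑ i, ∑ j, (A i j) ^ 2

/-- The larger singular value `α₁` of a 2×2 real matrix, i.e. the larger positive square
root of the eigenvalues of `AᵀA`, via the standard closed formula. -/
def sv1 (A : Matrix (Fin 2) (Fin 2) ℝ) : ℝ :=
  Real.sqrt ((frobSq A + Real.sqrt ((frobSq A) ^ 2 - 4 * (A.det) ^ 2)) / 2)

/-- The smaller singular value `α₂` of a 2×2 real matrix. -/
def sv2 (A : Matrix (Fin 2) (Fin 2) ℝ) : ℝ :=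
  Real.sqrt ((frobSq A - Real.sqrt ((frobSq A) ^ 2 - 4 * (A.det) ^ 2)) / 2)

/-- The nonlinear, non-conformal iterated function systems of Falconer, Fraser and Lee:
maps `S i (a₁,a₂) = (f i a₁, g i (a₁,a₂))` on the unit square, where `f i`, `g i` are
`C^{1+α}` contractions (with partial derivatives `fx`, `gx`, `gy`) satisfying the
domination condition. -/
structure System (I : Type) [Fintype I] where
  f : I → ℝ → ℝ
  g : I → ℝ × ℝ → ℝ
  fx : I → ℝ → ℝ
  gx : I → ℝ × ℝ → ℝ
  gy : I → ℝ × ℝ → ℝ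
  /-- the index set has at least two elements -/
  card2 : 2 ≤ Fintype.card I
  /-- each `S i` maps the unit square into itself -/
  mapsTo : ∀ i, Set.MapsTo (fun a => (f i a.1, g i a)) sq sq
  /-- `fx i` is the derivative of `f i` on `[0,1]` -/
  hasDeriv_f : ∀ i, ∀ x ∈ Set.Icc (0:ℝ) 1,
    HasDerivWithinAt (f i) (fx i x) (Set.Icc (0:ℝ) 1) x
  /-- `(gx i, gy i)` is the (total) derivative of `g i` on the unit square -/
  hasDeriv_g : ∀ i, ∀ a ∈ sq, HasFDerivWithinAt (g i)
      (gx i a • ContinuousLinearMap.fst ℝ ℝ ℝ + gy i a • ContinuousLinearMap.snd ℝ ℝ ℝ) sq a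
  /-- the derivatives are `α`-Hölder for some `α > 0`, i.e. `f i`, `g i` are `C^{1+α}` -/
  holder : ∃ α > (0:ℝ), ∃ H > (0:ℝ), ∀ i,
      (∀ x ∈ Set.Icc (0:ℝ) 1, ∀ y ∈ Set.Icc (0:ℝ) 1, |fx i x - fx i y| ≤ H * |x - y| ^ α) ∧
      (∀ a ∈ sq, ∀ b ∈ sq, |gx i a - gx i b| ≤ H * dE a b ^ α) ∧
      (∀ a ∈ sq, ∀ b ∈ sq, |gy i a - gy i b| ≤ H * dE a b ^ α)
  /-- the maps `f i`, `g i` (hence `S i`) are uniform contractions -/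
  contracting : ∃ c, 0 ≤ c ∧ c < 1 ∧ ∀ i,
      (∀ x ∈ Set.Icc (0:ℝ) 1, ∀ y ∈ Set.Icc (0:ℝ) 1, |f i x - f i y| ≤ c * |x - y|) ∧
      (∀ a ∈ sq, ∀ b ∈ sq, |g i a - g i b| ≤ c * dE a b) ∧
      (∀ a ∈ sq, ∀ b ∈ sq, dE (f i a.1, g i a) (f i b.1, g i b) ≤ c * dE a b)
  /-- the domination condition:
  `inf |f_{i,x}| > sup |g_{i,y}| ≥ inf |g_{i,y}| ≥ d > 0` -/
  domination : ∃ d > (0:ℝ), ∀ i,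
      d ≤ sInf ((fun a => |gy i a|) '' sq) ∧
      sSup ((fun a => |gy i a|) '' sq) < sInf ((fun x => |fx i x|) '' Set.Icc (0:ℝ) 1)

variable {I : Type} [Fintype I]

/-- The map `S i`. -/
def S (T : System I) (i : I) (a : ℝ × ℝ) : ℝ × ℝ := (T.f i a.1, T.g i a)

/-- The composition `S_w = S_{i₁} ∘ ⋯ ∘ S_{i_n}` along a finite word `w = (i₁,…,i_n)`. -/
def Sw (T : System I) : List I → ℝ × ℝ → ℝ × ℝ
  | [], a => a
  | i :: w, a => S T i (Sw T w a)

/-- The top-left entry `f_{w,x}(a)` of the (lower triangular) Jacobian `D_a S_w`,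
via the chain rule. -/
def fxw (T : System I) : List I → ℝ × ℝ → ℝ
  | [], _ => 1
  | i :: w, a => T.fx i (Sw T w a).1 * fxw T w a

/-- The bottom-right entry `g_{w,y}(a)` of the Jacobian `D_a S_w`. -/
def gyw (T : System I) : List I → ℝ × ℝ → ℝ
  | [], _ => 1
  | i :: w, a => T.gy i (Sw T w a) * gyw T w a

/-- The off-diagonal entry `g_{w,x}(a)` of the Jacobian `D_a S_w`. -/
def gxw (T : System I) : List I → ℝ × ℝ → ℝ
  | [], _ => 0
  | i :: w, a => T.gx i (Sw T w a) * fxw T w a + T.gy i (Sw T w a) * gxw T w a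

/-- The Jacobian matrix `D_a S_w`. -/
def Dmat (T : System I) (w : List I) (a : ℝ × ℝ) : Matrix (Fin 2) (Fin 2) ℝ :=
  !![fxw T w a, 0; gxw T w a, gyw T w a]

/-- The larger singular value `α₁(D_a S_w)`. -/
def alpha1 (T : System I) (w : List I) (a : ℝ × ℝ) : ℝ := sv1 (Dmat T w a)

/-- The smaller singular value `α₂(D_a S_w)`. -/
def alpha2 (T : System I) (w : List I) (a : ℝ × ℝ) : ℝ := sv2 (Dmat T w a)

/-- The restriction `i|n` of an infinite sequence to its first `n` symbols. -/
def word (ii : ℕ → I) (n : ℕ) : List I := List.ofFn (fun k : Fin n => ii k.1)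

/-- The iterated left shift `σⁿ`. -/
def shiftn (ii : ℕ → I) (n : ℕ) : ℕ → I := fun k => ii (k + n)

/-- The left shift `σ` on `Σ = I^ℕ`. -/
def shift (ii : ℕ → I) : ℕ → I := fun k => ii (k + 1)

/-- The cylinder set `[w] ⊆ Σ` of a finite word `w`. -/
def cyl (w : List I) : Set (ℕ → I) := {jj | ∀ k : Fin w.length, jj k.1 = w.get k}

/-- `F` is the attractor of the IFS: the (unique) nonempty compact subset of the unit
square with `F = ⋃ i, S i '' F`. -/
def IsAttractor (T : System I) (F : Set (ℝ × ℝ)) : Prop :=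
  F.Nonempty ∧ IsCompact F ∧ F ⊆ sq ∧ F = ⋃ i, S T i '' F

/-- The strong separation condition: the sets `S i '' F` are pairwise disjoint. -/
def SSC (T : System I) (F : Set (ℝ × ℝ)) : Prop :=
  ∀ i j : I, i ≠ j → Disjoint (S T i '' F) (S T j '' F)

/-- `Pi` is the canonical coding map `Π : Σ → [0,1]²`:
`Π(i)` is the unique point of `⋂ₙ S_{i|n}([0,1]²)`. -/
def IsCoding (T : System I) (Pi : (ℕ → I) → ℝ × ℝ) : Prop :=
  ∀ ii : ℕ → I, ∀ n : ℕ, Pi ii ∈ Sw T (word ii n) '' sq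

/-- `m` is quasi-Bernoulli with constant `L`:
`L⁻¹ m[w] m[v] ≤ m[wv] ≤ L m[w] m[v]` for all finite words `w, v`. -/
def QuasiBernoulli [MeasurableSpace I] (m : Measure (ℕ → I)) (L : ℝ) : Prop :=
  0 < L ∧ ∀ w v : List I,
    L⁻¹ * (m (cyl w)).toReal * (m (cyl v)).toReal ≤ (m (cyl (w ++ v))).toReal ∧
    (m (cyl (w ++ v))).toReal ≤ L * (m (cyl w)).toReal * (m (cyl v)).toReal

/-- The interval `Q₁(x,r) = [x - r/2, x + r/2]`. -/
def Q1 (x r : ℝ) : Set ℝ := Set.Icc (x - r / 2) (x + r / 2)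

/-- The square `Q₂(a,r) = (a₁ - r/2, a₁ + r/2) × (a₂ - r/2, a₂ + r/2)`. -/
def Q2 (a : ℝ × ℝ) (r : ℝ) : Set (ℝ × ℝ) :=
  Set.Ioo (a.1 - r / 2) (a.1 + r / 2) ×ˢ Set.Ioo (a.2 - r / 2) (a.2 + r / 2)

/-- The approximate square `B_n(a,r)`: points `b ∈ S_w([0,1]²)` with `|b₁ - a₁| ≤ r/2`. -/
def Bn (T : System I) (w : List I) (a : ℝ × ℝ) (r : ℝ) : Set (ℝ × ℝ) :=
  {b ∈ Sw T w '' sq | |b.1 - a.1| ≤ r / 2}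

/-- The closed Euclidean ball in `ℝ²`. -/
def ballE (x : ℝ × ℝ) (r : ℝ) : Set (ℝ × ℝ) := {y | dE x y ≤ r}

/-- A measure on `ℝ` is exact dimensional with dimension `s` if for a.e. `x`,
`log ν(B(x,r)) / log r → s` as `r → 0⁺`. -/
def ExactDim1 (ν : Measure ℝ) (s : ℝ) : Prop :=
  ∀ᵐ x ∂ν, Tendsto (fun r => Real.log (ν (Metric.closedBall x r)).toReal / Real.log r)
    (nhdsWithin 0 (Set.Ioi 0)) (nhds s)

/-- A measure on `ℝ²` is exact dimensional with dimension `s` (w.r.t. Euclidean balls). -/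
def ExactDim2 (ν : Measure (ℝ × ℝ)) (s : ℝ) : Prop :=
  ∀ᵐ x ∂ν, Tendsto (fun r => Real.log (ν (ballE x r)).toReal / Real.log r)
    (nhdsWithin 0 (Set.Ioi 0)) (nhds s)

/-- `η = sup_{i ∈ I, a, b ∈ [0,1]²} |g_{i,y}(a)| / |f_{i,x}(b)|`. -/
def eta (T : System I) : ℝ :=
  sSup {x : ℝ | ∃ i : I, ∃ a ∈ sq, ∃ b ∈ sq, x = |T.gy i a| / |T.fx i b.1|}

end FFL

namespace FFL

variable {I : Type} [Fintype I]

lemma zero_mem_sq : ((0, 0) : ℝ × ℝ) ∈ sq := by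
  simp [sq]

lemma dE_zero_rpow_le {a : ℝ × ℝ} (ha : a ∈ sq) {α : ℝ} (hα : 0 < α) :
    dE a (0, 0) ^ α ≤ 2 ^ α := by
  obtain ⟨⟨h1, h2⟩, h3, h4⟩ := ha
  refine Real.rpow_le_rpow (Real.sqrt_nonneg _) ?_ hα.le
  refine Real.sqrt_le_iff.2 ⟨by norm_num, ?_⟩
  simp only [sub_zero]
  nlinarith

lemma Sw_mem_sq (T : System I) (w : List I) {a : ℝ × ℝ} (ha : a ∈ sq) : Sw T w a ∈ sq := by
  induction w with
  | nil => exact ha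
  | cons i w ih => exact T.mapsTo i ih

lemma exists_abs_gx_le (T : System I) : ∃ G, 0 ≤ G ∧ ∀ i, ∀ a ∈ sq, |T.gx i a| ≤ G := by
  obtain ⟨α, hα, H, hH, h⟩ := T.holder
  refine ⟨∑ i, |T.gx i (0, 0)| + H * 2 ^ α, by positivity, fun i a ha => ?_⟩
  have h1 := (h i).2.1 a ha _ zero_mem_sq
  have h2 := mul_le_mul_of_nonneg_left (dE_zero_rpow_le ha hα) hH.le
  have h3 := abs_sub_abs_le_abs_sub (T.gx i a) (T.gx i (0, 0))
  have h4 : |T.gx i (0, 0)| ≤ ∑ i, |T.gx i (0, 0)| :=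
    Finset.single_le_sum (f := fun i => |T.gx i (0, 0)|) (fun _ _ => abs_nonneg _)
      (Finset.mem_univ i)
  linarith

lemma bddAbove_abs_gy (T : System I) (i : I) : BddAbove ((fun a => |T.gy i a|) '' sq) := by
  obtain ⟨α, hα, H, hH, h⟩ := T.holder
  refine ⟨|T.gy i (0, 0)| + H * 2 ^ α, ?_⟩
  rintro _ ⟨a, ha, rfl⟩
  have h1 := (h i).2.2 a ha _ zero_mem_sq
  have h2 := mul_le_mul_of_nonneg_left (dE_zero_rpow_le ha hα) hH.le
  have h3 := abs_sub_abs_le_abs_sub (T.gy i a) (T.gy i (0, 0))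
  dsimp only
  linarith

/-- The domination condition, with a uniform ratio `η < 1` and a uniform lower bound
for `|f_{i,x}|`. -/
lemma exists_domination (T : System I) : ∃ d > (0 : ℝ), ∃ η, 0 ≤ η ∧ η < 1 ∧
    (∀ i, ∀ x ∈ Icc (0 : ℝ) 1, d ≤ |T.fx i x|) ∧
    ∀ i, ∀ a ∈ sq, ∀ x ∈ Icc (0 : ℝ) 1, |T.gy i a| ≤ η * |T.fx i x| := by
  obtain ⟨d, hd, h⟩ := T.domination
  have : Nonempty I := Fintype.card_pos_iff.1 (by have := T.card2; omega)
  set M : I → ℝ := fun i => sSup ((fun a => |T.gy i a|) '' sq)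
  set m : I → ℝ := fun i => sInf ((fun x => |T.fx i x|) '' Icc (0 : ℝ) 1)
  have hlt : ∀ i, M i < m i := fun i => (h i).2
  have hgy : ∀ i, ∀ a ∈ sq, |T.gy i a| ≤ M i := fun i a ha =>
    le_csSup (bddAbove_abs_gy T i) ⟨a, ha, rfl⟩
  have hfx : ∀ i, ∀ x ∈ Icc (0 : ℝ) 1, m i ≤ |T.fx i x| := fun i x hx =>
    csInf_le ⟨0, by rintro _ ⟨y, -, rfl⟩; exact abs_nonneg _⟩ ⟨x, hx, rfl⟩
  have hdM : ∀ i, d ≤ M i := fun i =>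
    ((h i).1.trans (csInf_le ⟨0, by rintro _ ⟨y, -, rfl⟩; exact abs_nonneg _⟩
      ⟨_, zero_mem_sq, rfl⟩)).trans (hgy i _ zero_mem_sq)
  have hMpos : ∀ i, 0 < M i := fun i => hd.trans_le (hdM i)
  have hmpos : ∀ i, 0 < m i := fun i => (hMpos i).trans (hlt i)
  obtain ⟨j, hj⟩ := Finite.exists_max fun i => M i / m i
  refine ⟨d, hd, M j / m j, (div_pos (hMpos j) (hmpos j)).le,
    (div_lt_one (hmpos j)).2 (hlt j), fun i x hx => ?_, fun i a ha x hx => ?_⟩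
  · exact ((hdM i).trans (hlt i).le).trans (hfx i x hx)
  · calc |T.gy i a| ≤ M i := hgy i a ha
      _ = M i / m i * m i := (div_mul_cancel₀ _ (hmpos i).ne').symm
      _ ≤ M j / m j * |T.fx i x| :=
        mul_le_mul (hj i) (hfx i x hx) (hmpos i).le (div_pos (hMpos j) (hmpos j)).le

lemma fxw_ne_zero (T : System I) (w : List I) {a : ℝ × ℝ} (ha : a ∈ sq) : fxw T w a ≠ 0 := by
  obtain ⟨d, hd, -, -, -, hfx, -⟩ := exists_domination T
  induction w with
  | nil => exact one_ne_zero
  | cons i w ih =>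
    exact mul_ne_zero (abs_pos.1 (hd.trans_le (hfx i _ (Sw_mem_sq T w ha).1))) ih

lemma exists_abs_gxw_le (T : System I) :
    ∃ K, 0 ≤ K ∧ ∀ w, ∀ a ∈ sq, |gxw T w a| ≤ K * |fxw T w a| := by
  obtain ⟨d, hd, η, hη0, hη1, hfx, hgy⟩ := exists_domination T
  obtain ⟨G, hG, hgx⟩ := exists_abs_gx_le T
  have hη : 0 < 1 - η := sub_pos.2 hη1
  have hK : 0 ≤ G / d / (1 - η) := by positivity
  refine ⟨G / d / (1 - η), hK, fun w a ha => ?_⟩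
  induction w with
  | nil => simpa [gxw, fxw] using hK
  | cons i w ih =>
    set K := G / d / (1 - η)
    have hKeq : G / d + η * K = K := by
      have : K * (1 - η) = G / d := div_mul_cancel₀ _ hη.ne'
      linarith
    have hp := Sw_mem_sq T w ha
    have h1 : |T.gx i (Sw T w a)| ≤ G / d * |T.fx i (Sw T w a).1| := by
      calc |T.gx i (Sw T w a)| ≤ G := hgx i _ hp
        _ = G / d * d := (div_mul_cancel₀ _ hd.ne').symm
        _ ≤ _ := mul_le_mul_of_nonneg_left (hfx i _ hp.1) (by positivity)
    have h2 := hgy i _ hp _ hp.1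
    simp only [gxw, fxw]
    calc |T.gx i (Sw T w a) * fxw T w a + T.gy i (Sw T w a) * gxw T w a|
        ≤ |T.gx i (Sw T w a)| * |fxw T w a| + |T.gy i (Sw T w a)| * |gxw T w a| := by
          rw [← abs_mul, ← abs_mul]; exact abs_add_le _ _
      _ ≤ G / d * |T.fx i (Sw T w a).1| * |fxw T w a|
          + η * |T.fx i (Sw T w a).1| * (K * |fxw T w a|) := by gcongr
      _ = (G / d + η * K) * |T.fx i (Sw T w a).1 * fxw T w a| := by rw [abs_mul]; ring
      _ = K * |T.fx i (Sw T w a).1 * fxw T w a| := by rw [hKeq]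

lemma abs_Sw_fst_sub_le (T : System I) {c : ℝ} (hc : 0 ≤ c)
    (h : ∀ i, ∀ x ∈ Icc (0 : ℝ) 1, ∀ y ∈ Icc (0 : ℝ) 1, |T.f i x - T.f i y| ≤ c * |x - y|)
    (w : List I) {a b : ℝ × ℝ} (ha : a ∈ sq) (hb : b ∈ sq) :
    |(Sw T w a).1 - (Sw T w b).1| ≤ c ^ w.length := by
  induction w with
  | nil =>
    obtain ⟨⟨h1, h2⟩, -⟩ := ha
    obtain ⟨⟨h3, h4⟩, -⟩ := hb
    simp only [Sw, List.length_nil, pow_zero]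
    exact abs_le.2 ⟨by linarith, by linarith⟩
  | cons i w ih =>
    rw [List.length_cons, pow_succ']
    exact (h i _ (Sw_mem_sq T w ha).1 _ (Sw_mem_sq T w hb).1).trans
      (mul_le_mul_of_nonneg_left ih hc)

/-- Bounded distortion of the top diagonal Jacobian entry. -/
lemma exists_abs_fxw_le (T : System I) :
    ∃ D, 0 ≤ D ∧ ∀ w, ∀ a ∈ sq, ∀ b ∈ sq, |fxw T w a| ≤ D * |fxw T w b| := by
  obtain ⟨d, hd, -, -, -, hfx, -⟩ := exists_domination T
  obtain ⟨α, hα, H, hH, hhol⟩ := T.holder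
  obtain ⟨c, hc0, hc1, hcon⟩ := T.contracting
  have hr0 : 0 ≤ c ^ α := Real.rpow_nonneg hc0 α
  have hr1 : c ^ α < 1 := Real.rpow_lt_one hc0 hc1 hα
  refine ⟨Real.exp (H / d * ∑' k : ℕ, (c ^ α) ^ k), (Real.exp_pos _).le,
    fun w a ha b hb => ?_⟩
  have key : |fxw T w a|
      ≤ Real.exp (H / d * ∑ k ∈ Finset.range w.length, (c ^ α) ^ k) * |fxw T w b| := by
    induction w with
    | nil => simp [fxw]
    | cons i w ih =>
      have hpa := (Sw_mem_sq T w ha).1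
      have hpb := (Sw_mem_sq T w hb).1
      have h1 := (hhol i).1 _ hpa _ hpb
      have h2 : |(Sw T w a).1 - (Sw T w b).1| ^ α ≤ (c ^ α) ^ w.length := by
        calc |(Sw T w a).1 - (Sw T w b).1| ^ α ≤ (c ^ w.length) ^ α :=
              Real.rpow_le_rpow (abs_nonneg _)
                (abs_Sw_fst_sub_le T hc0 (fun i => (hcon i).1) w ha hb) hα.le
          _ = (c ^ α) ^ w.length := by
              rw [← Real.rpow_natCast, ← Real.rpow_natCast, ← Real.rpow_mul hc0,
                ← Real.rpow_mul hc0, mul_comm]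
      have h3 : |T.fx i (Sw T w a).1|
          ≤ Real.exp (H / d * (c ^ α) ^ w.length) * |T.fx i (Sw T w b).1| := by
        have h4 := abs_sub_abs_le_abs_sub (T.fx i (Sw T w a).1) (T.fx i (Sw T w b).1)
        have h5 : H * (c ^ α) ^ w.length
            ≤ H / d * (c ^ α) ^ w.length * |T.fx i (Sw T w b).1| := by
          calc H * (c ^ α) ^ w.length = H / d * (c ^ α) ^ w.length * d := by field_simp
            _ ≤ _ := mul_le_mul_of_nonneg_left (hfx i _ hpb) (by positivity)
        have h6 := mul_le_mul_of_nonneg_left h2 hH.le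
        calc |T.fx i (Sw T w a).1|
            ≤ (H / d * (c ^ α) ^ w.length + 1) * |T.fx i (Sw T w b).1| := by linarith
          _ ≤ _ := mul_le_mul_of_nonneg_right (Real.add_one_le_exp _) (abs_nonneg _)
      simp only [fxw, List.length_cons, Finset.sum_range_succ, mul_add, Real.exp_add, abs_mul]
      calc |T.fx i (Sw T w a).1| * |fxw T w a| ≤ _ :=
            mul_le_mul h3 ih (abs_nonneg _) (by positivity)
        _ = _ := by ring
  refine key.trans ?_
  gcongr
  exact (summable_geometric_of_lt_one hr0 hr1).sum_le_tsum _ fun k _ => pow_nonneg hr0 k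

end FFL

open FFL

/-- uniform bound on the ratio of the off-diagonal and the top diagonal
Jacobian entries. -/
theorem stmt1 {I : Type} [Fintype I] (T : System I) :
    ∃ C > (0:ℝ), ∀ (ii : ℕ → I) (n : ℕ), ∀ a ∈ sq, ∀ b ∈ sq,
      |gxw T (word ii n) a| / |fxw T (word ii n) b| ≤ C := by
  obtain ⟨K, hK, hgxw⟩ := exists_abs_gxw_le T
  obtain ⟨D, hD, hfxw⟩ := exists_abs_fxw_le T
  refine ⟨K * D + 1, by positivity, fun ii n a ha b hb => ?_⟩
  rw [div_le_iff₀ (abs_pos.2 (fxw_ne_zero T _ hb))]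
  calc |gxw T (word ii n) a| ≤ K * |fxw T (word ii n) a| := hgxw _ a ha
    _ ≤ K * (D * |fxw T (word ii n) b|) := mul_le_mul_of_nonneg_left (hfxw _ a ha b hb) hK
    _ ≤ (K * D + 1) * |fxw T (word ii n) b| := by
      linarith [abs_nonneg (fxw T (word ii n) b)]
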